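/- arXiv:1205.5614 — 2 statements merged into one kernel-verified Lean document; each statement's English description precedes it below -/
import Mathlib

section
/- Let H₂ be an n_d × n_r complex matrix, a ≥ 0 a real constant, and suppose v ∈ ℂ^{n_r} is a nonzero vector with (H₂ᴴ·H₂)·v = μ·v for some real μ. Then μ ≥ 0 and (H₂ᴴ·(a·H₂·H₂ᴴ + I)⁻¹·H₂)·v = (μ/(a·μ + 1))·v. That is, every eigenvalue λ² of H₂ᴴ·H₂ (with λ a singular value of H₂) gives rise to the eigenvalue β = λ²/(a·λ² + 1) of H₂ᴴ·(a·H₂·H₂ᴴ + I)⁻¹·H₂, with the same eigenvector. -/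
open Matrix

open scoped ComplexOrder in
/-- A real eigenvalue of a positive semidefinite complex matrix is nonnegative. -/
theorem Matrix.PosSemidef.nonneg_of_mulVec_eq_smul {n : Type*} [Fintype n]
    {A : Matrix n n ℂ} (hA : A.PosSemidef) {v : n → ℂ} (hv : v ≠ 0) {μ : ℝ}
    (h : A *ᵥ v = (μ : ℂ) • v) : 0 ≤ μ := by
  have h₁ : 0 ≤ (μ : ℂ) * (star v ⬝ᵥ v) := by
    simpa [h, dotProduct_smul] using hA.dotProduct_mulVec_nonneg v
  have h₂ : 0 < star v ⬝ᵥ v := dotProduct_star_self_pos_iff.mpr hv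
  by_contra! hneg
  have h₃ : (μ : ℂ) < 0 := by exact_mod_cast hneg
  exact (mul_neg_of_neg_of_pos h₃ h₂).not_ge h₁

open scoped ComplexOrder in
theorem Matrix.isUnit_det_smul_mul_conjTranspose_add_one {m n : Type*} [Fintype m]
    [DecidableEq m] [Fintype n] (H : Matrix m n ℂ) {a : ℝ} (ha : 0 ≤ a) :
    IsUnit ((a : ℂ) • (H * Hᴴ) + 1).det := by
  have h : ((a : ℂ) • (H * Hᴴ)).PosSemidef :=
    (posSemidef_self_mul_conjTranspose H).smul (by exact_mod_cast ha)
  exact (isUnit_iff_isUnit_det _).mp (PosDef.posSemidef_add h PosDef.one).isUnit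

/-- If `v ≠ 0` satisfies `(H₂ᴴ·H₂)·v = μ·v` for a real `μ`, then
`μ ≥ 0` and `(H₂ᴴ·(a·H₂·H₂ᴴ + I)⁻¹·H₂)·v = (μ/(a·μ + 1))·v`. -/
theorem stmt3 {nd nr : ℕ} (H₂ : Matrix (Fin nd) (Fin nr) ℂ) (a : ℝ) (ha : 0 ≤ a)
    (v : Fin nr → ℂ) (hv : v ≠ 0) (μ : ℝ)
    (hμ : (H₂ᴴ * H₂) *ᵥ v = (μ : ℂ) • v) :
    0 ≤ μ ∧
    (H₂ᴴ * ((a : ℂ) • (H₂ * H₂ᴴ) + 1)⁻¹ * H₂) *ᵥ v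
      = ((μ / (a * μ + 1) : ℝ) : ℂ) • v := by
  have hμ0 : 0 ≤ μ := by
    open scoped ComplexOrder in
    exact (posSemidef_conjTranspose_mul_self H₂).nonneg_of_mulVec_eq_smul hv hμ
  refine ⟨hμ0, ?_⟩
  have hdet := isUnit_det_smul_mul_conjTranspose_add_one H₂ ha
  set M := (a : ℂ) • (H₂ * H₂ᴴ) + 1 with hM
  have hc : ((a * μ + 1 : ℝ) : ℂ) ≠ 0 := by
    exact_mod_cast (by positivity : a * μ + 1 ≠ 0)
  have hMv : M *ᵥ (H₂ *ᵥ v) = ((a * μ + 1 : ℝ) : ℂ) • (H₂ *ᵥ v) := by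
    rw [hM, add_mulVec, smul_mulVec, one_mulVec, ← mulVec_mulVec, mulVec_mulVec v H₂ᴴ, hμ,
      mulVec_smul, smul_smul]
    push_cast
    rw [add_smul, one_smul]
  have hinv : M⁻¹ *ᵥ (H₂ *ᵥ v) = ((a * μ + 1 : ℝ) : ℂ)⁻¹ • (H₂ *ᵥ v) := by
    rw [eq_inv_smul_iff₀ hc, ← mulVec_smul, ← hMv, mulVec_mulVec, nonsing_inv_mul _ hdet,
      one_mulVec]
  rw [← mulVec_mulVec, ← mulVec_mulVec, hinv, mulVec_smul, mulVec_mulVec, hμ, smul_smul,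
    Complex.ofReal_div, div_eq_inv_mul]
end

section
/- Let H₁ be an n_r × n_s complex matrix, H₂ an n_d × n_r complex matrix, a ≥ 0 real, and suppose H₁·H₁ᴴ = c·I for some real c > 0. Then the largest eigenvalue of A = H₁ᴴ·H₂ᴴ·(a·H₂·H₂ᴴ + I)⁻¹·H₂·H₁ satisfies λ_max(A) = c·μ/(a·μ + 1), where μ = λ_max(H₂ᴴ·H₂). (This is the deterministic content of the large-n_s case of Theorem 7: when H₁·H₁ᴴ/n_s = I, λ_max = n_s·λ_max1/(a·λ_max1 + 1) with λ_max1 the largest eigenvalue of H₂ᴴ·H₂.) -/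
open Matrix

/-- The eigenvalues of a Hermitian matrix are the real scalars admitting an eigenvector. -/
lemma Matrix.IsHermitian.exists_eigenvalues_eq_iff {n : Type*} [Fintype n] [DecidableEq n]
    {A : Matrix n n ℂ} (hA : A.IsHermitian) (r : ℝ) :
    (∃ i, hA.eigenvalues i = r) ↔ ∃ v : n → ℂ, v ≠ 0 ∧ A *ᵥ v = (r : ℂ) • v := by
  have h : (∃ i, hA.eigenvalues i = r) ↔ (r : ℂ) ∈ spectrum ℂ A := by
    rw [hA.spectrum_eq_image_range]
    simp
  rw [h, ← Matrix.spectrum_toLin', ← Module.End.hasEigenvalue_iff_mem_spectrum]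
  constructor
  · intro hr
    obtain ⟨v, hv⟩ := hr.exists_hasEigenvector
    exact ⟨v, hv.2, by simpa using hv.apply_eq_smul⟩
  · rintro ⟨v, hv0, hv⟩
    exact Module.End.hasEigenvalue_of_hasEigenvector
      (Module.End.hasEigenvector_iff.mpr
        ⟨Module.End.mem_eigenspace_iff.mpr (by simpa using hv), hv0⟩)

section ComplexOrder

open scoped ComplexOrder

lemma Matrix.IsHermitian.eigenvalues_conjTranspose_mul_self_nonneg {m n : Type*} [Fintype m]
    [Fintype n] [DecidableEq n] {H : Matrix m n ℂ} (h : (Hᴴ * H).IsHermitian) (j : n) :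
    0 ≤ h.eigenvalues j :=
  (posSemidef_conjTranspose_mul_self H).eigenvalues_nonneg j

lemma Matrix.isUnit_smul_mul_conjTranspose_add_one {m n : Type*} [Fintype m] [Fintype n]
    [DecidableEq m] (H : Matrix m n ℂ) {a : ℝ} (ha : 0 ≤ a) :
    IsUnit ((a : ℂ) • (H * Hᴴ) + 1) := by
  refine PosDef.isUnit (PosDef.posSemidef_add ?_ PosDef.one)
  exact (posSemidef_self_mul_conjTranspose H).smul (by exact_mod_cast ha)

end ComplexOrder

section RelayEigenvectors

variable {m n p : Type*} [Fintype m] [Fintype n] [Fintype p] [DecidableEq m] [DecidableEq n]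

/-- An eigenvector `v` of `Hᴴ * H` is mapped by `Kᴴ` to an eigenvector of the relay matrix. -/
lemma Matrix.relay_mulVec_of_gram_mulVec {K : Matrix n p ℂ} {H : Matrix m n ℂ} {a c ν : ℝ}
    (hK : K * Kᴴ = (c : ℂ) • 1) (hU : IsUnit ((a : ℂ) • (H * Hᴴ) + 1)) (hν : a * ν + 1 ≠ 0)
    {v : n → ℂ} (hv : (Hᴴ * H) *ᵥ v = (ν : ℂ) • v) :
    (Kᴴ * Hᴴ * ((a : ℂ) • (H * Hᴴ) + 1)⁻¹ * H * K) *ᵥ (Kᴴ *ᵥ v)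
      = ((c * ν / (a * ν + 1) : ℝ) : ℂ) • (Kᴴ *ᵥ v) := by
  set M := (a : ℂ) • (H * Hᴴ) + 1 with hM
  have hν' : (a * ν + 1 : ℂ) ≠ 0 := by exact_mod_cast hν
  have hdet : IsUnit M.det := (isUnit_iff_isUnit_det M).mp hU
  have hMv : M *ᵥ (H *ᵥ v) = (a * ν + 1 : ℂ) • (H *ᵥ v) := by
    have : (H * Hᴴ) *ᵥ (H *ᵥ v) = (ν : ℂ) • (H *ᵥ v) := by
      rw [mulVec_mulVec, Matrix.mul_assoc, ← mulVec_mulVec, hv, mulVec_smul]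
    rw [hM, add_mulVec, smul_mulVec, this, one_mulVec, smul_smul, add_smul, one_smul]
  have hMinv : M⁻¹ *ᵥ (H *ᵥ v) = (a * ν + 1 : ℂ)⁻¹ • (H *ᵥ v) := by
    rw [eq_inv_smul_iff₀ hν', ← mulVec_smul, ← hMv, mulVec_mulVec, nonsing_inv_mul _ hdet,
      one_mulVec]
  have hKv : K *ᵥ (Kᴴ *ᵥ v) = (c : ℂ) • v := by
    rw [mulVec_mulVec, hK, smul_mulVec, one_mulVec]
  rw [← mulVec_mulVec, hKv, ← mulVec_mulVec, ← mulVec_mulVec, mulVec_smul, mulVec_smul, hMinv,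
    ← mulVec_mulVec]
  simp only [mulVec_smul]
  rw [mulVec_mulVec v Hᴴ H, hv]
  simp only [mulVec_smul, smul_smul]
  congr 1
  push_cast
  field_simp

/-- An eigenvector `x` of the relay matrix is mapped by `K` to a vector `y` satisfying a scaled
eigenvector equation for `Hᴴ * H`. -/
lemma Matrix.gram_mulVec_of_relay_mulVec {K : Matrix n p ℂ} {H : Matrix m n ℂ} {a c r : ℝ}
    (hK : K * Kᴴ = (c : ℂ) • 1) (hU : IsUnit ((a : ℂ) • (H * Hᴴ) + 1))
    {x : p → ℂ}
    (hx : (Kᴴ * Hᴴ * ((a : ℂ) • (H * Hᴴ) + 1)⁻¹ * H * K) *ᵥ x = (r : ℂ) • x) :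
    (c - r * a : ℂ) • ((Hᴴ * H) *ᵥ (K *ᵥ x)) = (r : ℂ) • (K *ᵥ x) := by
  set M := (a : ℂ) • (H * Hᴴ) + 1 with hM
  have hdet : IsUnit M.det := (isUnit_iff_isUnit_det M).mp hU
  set y := K *ᵥ x
  set w := M⁻¹ *ᵥ (H *ᵥ y) with hw
  have hMw : (a : ℂ) • (H *ᵥ (Hᴴ *ᵥ w)) + w = H *ᵥ y := by
    have : M *ᵥ w = H *ᵥ y := by rw [hw, mulVec_mulVec, mul_nonsing_inv _ hdet, one_mulVec]
    rwa [hM, add_mulVec, smul_mulVec, one_mulVec, ← mulVec_mulVec] at this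
  have hwy : (c : ℂ) • (Hᴴ *ᵥ w) = (r : ℂ) • y := by
    have h := congrArg (K *ᵥ ·) hx
    simp only [← mulVec_mulVec, mulVec_smul] at h
    rw [mulVec_mulVec _ K, hK, smul_mulVec, one_mulVec] at h
    exact h
  have hG : (c : ℂ) • (Hᴴ *ᵥ (H *ᵥ y)) = (a * r : ℂ) • (Hᴴ *ᵥ (H *ᵥ y)) + (r : ℂ) • y := by
    have h := congrArg (fun z => (c : ℂ) • (Hᴴ *ᵥ z)) hMw
    simp only [mulVec_add, mulVec_smul, smul_add] at h
    rw [← h, hwy, smul_comm (c : ℂ) (a : ℂ), ← mulVec_smul Hᴴ, ← mulVec_smul H, hwy]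
    simp only [mulVec_smul, smul_smul]
  rw [← mulVec_mulVec, sub_smul, hG, mul_comm (r : ℂ) a, add_sub_cancel_left]

end RelayEigenvectors

/-- If `H₁·H₁ᴴ = c·I` with `c > 0`, then the largest eigenvalue of
`A = H₁ᴴ·H₂ᴴ·(a·H₂·H₂ᴴ + I)⁻¹·H₂·H₁` equals `c·μ/(a·μ + 1)` where
`μ = λ_max(H₂ᴴ·H₂)`. -/
theorem stmt7 {ns nr nd : ℕ} (H₁ : Matrix (Fin nr) (Fin ns) ℂ)
    (H₂ : Matrix (Fin nd) (Fin nr) ℂ) (a c : ℝ) (ha : 0 ≤ a) (hc : 0 < c)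
    (hH₁ : H₁ * H₁ᴴ = (c : ℂ) • 1)
    (A : Matrix (Fin ns) (Fin ns) ℂ)
    (hA : A = H₁ᴴ * H₂ᴴ * ((a : ℂ) • (H₂ * H₂ᴴ) + 1)⁻¹ * H₂ * H₁) :
    ∀ (h1 : A.IsHermitian) (h2 : (H₂ᴴ * H₂).IsHermitian),
      (⨆ i, h1.eigenvalues i)
        = c * (⨆ i, h2.eigenvalues i) / (a * (⨆ i, h2.eigenvalues i) + 1) := by
  intro h1 h2
  subst hA
  have hU := isUnit_smul_mul_conjTranspose_add_one H₂ ha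
  have hc' : (c : ℂ) ≠ 0 := by exact_mod_cast hc.ne'
  have hnonneg : ∀ j, 0 ≤ h2.eigenvalues j :=
    h2.eigenvalues_conjTranspose_mul_self_nonneg
  set μ := ⨆ i, h2.eigenvalues i
  have hμ0 : 0 ≤ μ := Real.iSup_nonneg hnonneg
  have hden : ∀ ν : ℝ, 0 ≤ ν → 0 < a * ν + 1 := fun ν hν => by positivity
  have hle : ∀ i, h1.eigenvalues i ≤ c * μ / (a * μ + 1) := by
    intro i
    set r := h1.eigenvalues i
    rcases le_or_gt r 0 with hr0 | hr0
    · have := hden μ hμ0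
      exact hr0.trans (by positivity)
    obtain ⟨x, hx0, hx⟩ := (h1.exists_eigenvalues_eq_iff r).mp ⟨i, rfl⟩
    have hrC : (r : ℂ) ≠ 0 := by exact_mod_cast hr0.ne'
    have hy0 : H₁ *ᵥ x ≠ 0 := by
      intro h
      rw [← mulVec_mulVec, h, mulVec_zero] at hx
      exact (smul_ne_zero hrC hx0) hx.symm
    have hG := gram_mulVec_of_relay_mulVec hH₁ hU hx
    have hd : c - r * a ≠ 0 := by
      intro h
      have h' : (c - r * a : ℂ) = 0 := by exact_mod_cast h
      rw [h', zero_smul] at hG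
      exact (smul_ne_zero hrC hy0) hG.symm
    have hdC : (c - r * a : ℂ) ≠ 0 := by exact_mod_cast hd
    obtain ⟨j, hj⟩ := (h2.exists_eigenvalues_eq_iff (r / (c - r * a))).mpr
      ⟨H₁ *ᵥ x, hy0, by
        rw [(eq_inv_smul_iff₀ hdC).mpr hG, smul_smul, div_eq_inv_mul]
        push_cast
        rfl⟩
    have hjμ : h2.eigenvalues j ≤ μ := le_ciSup (Set.finite_range _).bddAbove j
    have hdpos : 0 < c - r * a := by
      refine lt_of_le_of_ne ?_ hd.symm
      by_contra! hneg
      exact (div_neg_of_pos_of_neg hr0 hneg).not_ge (hj ▸ hnonneg j)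
    rw [hj, div_le_iff₀ hdpos] at hjμ
    rw [le_div_iff₀ (hden μ hμ0)]
    linarith
  rcases isEmpty_or_nonempty (Fin nr) with hemp | hne
  · have hμz : μ = 0 := Real.iSup_of_isEmpty _
    have hA0 : H₁ᴴ * H₂ᴴ * ((a : ℂ) • (H₂ * H₂ᴴ) + 1)⁻¹ * H₂ * H₁ = 0 := by
      rw [Subsingleton.elim H₁ 0, Matrix.mul_zero]
    have hz : h1.eigenvalues = 0 := h1.eigenvalues_eq_zero_iff.mpr hA0
    simp [hz, hμz]
  obtain ⟨j, hj⟩ := exists_eq_ciSup_of_finite (f := h2.eigenvalues)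
  obtain ⟨v, hv0, hv⟩ := (h2.exists_eigenvalues_eq_iff μ).mp ⟨j, hj⟩
  have hKv0 : H₁ᴴ *ᵥ v ≠ 0 := by
    intro h
    have h' := congrArg (H₁ *ᵥ ·) h
    simp only [mulVec_mulVec, hH₁, smul_mulVec, one_mulVec, mulVec_zero] at h'
    exact smul_ne_zero hc' hv0 h'
  obtain ⟨i, hi⟩ := (h1.exists_eigenvalues_eq_iff _).mpr
    ⟨_, hKv0, relay_mulVec_of_gram_mulVec hH₁ hU (hden μ hμ0).ne' hv⟩
  have : Nonempty (Fin ns) := ⟨i⟩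
  exact le_antisymm (ciSup_le hle) (hi ▸ le_ciSup (Set.finite_range h1.eigenvalues).bddAbove i)
end
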